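/- Let c be a real number. With J₁ = x₂p₃ − x₃p₂, J₂ = x₃p₁ − x₁p₃, J₃ = x₁p₂ − x₂p₁, define the Kowalevsky integrals H = J₁² + J₂² + 2J₃² + c x₁ and K = (J₁² − J₂² − c x₁)² + (2J₁J₂ − c x₂)². Then {H, K}_S = 0 at every point of the constraint surface T*S² (where x₁²+x₂²+x₃² = 1 and x₁p₁+x₂p₂+x₃p₃ = 0). -/

import Mathlib

noncomputable section

/-- Phase space T*ℝ³ = ℝ³ × ℝ³ with coordinates (x, p). -/
abbrev Phase : Type := (Fin 3 → ℝ) × (Fin 3 → ℝ)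

/-- Canonical Poisson bracket on ℝ³ × ℝ³:
{f,g} = Σᵢ (∂f/∂xᵢ ∂g/∂pᵢ − ∂f/∂pᵢ ∂g/∂xᵢ). -/
noncomputable def pb (f g : Phase → ℝ) (z : Phase) : ℝ :=
  ∑ i : Fin 3,
    (fderiv ℝ f z (Pi.single i 1, 0) * fderiv ℝ g z (0, Pi.single i 1) -
     fderiv ℝ f z (0, Pi.single i 1) * fderiv ℝ g z (Pi.single i 1, 0))

/-- Dirac bracket associated with constraints F₁, F₂:
{f,g}_D = {f,g} − ({F₁,f}{F₂,g} − {F₁,g}{F₂,f})/{F₁,F₂}. -/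
noncomputable def dirac (F₁ F₂ f g : Phase → ℝ) (z : Phase) : ℝ :=
  pb f g z - (pb F₁ f z * pb F₂ g z - pb F₁ g z * pb F₂ f z) / pb F₁ F₂ z
/-- Sphere constraint F₁ = x₁² + x₂² + x₃² − 1. -/
def sphereF₁ : Phase → ℝ := fun z => z.1 0 ^ 2 + z.1 1 ^ 2 + z.1 2 ^ 2 - 1

/-- Sphere constraint F₂ = x₁p₁ + x₂p₂ + x₃p₃. -/
def sphereF₂ : Phase → ℝ := fun z => z.1 0 * z.2 0 + z.1 1 * z.2 1 + z.1 2 * z.2 2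

/-- Sphere Dirac bracket {·,·}_S. -/
noncomputable def diracS (f g : Phase → ℝ) (z : Phase) : ℝ :=
  dirac sphereF₁ sphereF₂ f g z

/-- Angular momentum J₁ = x₂p₃ − x₃p₂. -/
noncomputable def J1 : Phase → ℝ := fun z => z.1 1 * z.2 2 - z.1 2 * z.2 1
/-- Angular momentum J₂ = x₃p₁ − x₁p₃. -/
noncomputable def J2 : Phase → ℝ := fun z => z.1 2 * z.2 0 - z.1 0 * z.2 2
/-- Angular momentum J₃ = x₁p₂ − x₂p₁. -/
noncomputable def J3 : Phase → ℝ := fun z => z.1 0 * z.2 1 - z.1 1 * z.2 0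

open ContinuousLinearMap in
theorem hasFDerivAt_position (i : Fin 3) (z : Phase) :
    HasFDerivAt (fun w : Phase => w.1 i) ((proj i : (Fin 3 → ℝ) →L[ℝ] ℝ).comp (fst ℝ _ _)) z :=
  ((proj i : (Fin 3 → ℝ) →L[ℝ] ℝ).comp (fst ℝ (Fin 3 → ℝ) (Fin 3 → ℝ))).hasFDerivAt (x := z)

open ContinuousLinearMap in
theorem hasFDerivAt_momentum (i : Fin 3) (z : Phase) :
    HasFDerivAt (fun w : Phase => w.2 i) ((proj i : (Fin 3 → ℝ) →L[ℝ] ℝ).comp (snd ℝ _ _)) z :=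
  ((proj i : (Fin 3 → ℝ) →L[ℝ] ℝ).comp (snd ℝ (Fin 3 → ℝ) (Fin 3 → ℝ))).hasFDerivAt (x := z)

theorem fderiv_sphereF₁ (z v : Phase) :
    fderiv ℝ sphereF₁ z v = 2 * (z.1 0 * v.1 0 + z.1 1 * v.1 1 + z.1 2 * v.1 2) := by
  have h := ((((hasFDerivAt_position 0 z).pow 2).add ((hasFDerivAt_position 1 z).pow 2)).add
    ((hasFDerivAt_position 2 z).pow 2)).sub_const 1
  have h' : HasFDerivAt sphereF₁ _ z := h
  rw [h'.fderiv]
  simp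
  ring

theorem differentiable_J1 : Differentiable ℝ J1 := by unfold J1; fun_prop

theorem differentiable_J2 : Differentiable ℝ J2 := by unfold J2; fun_prop

theorem differentiable_J3 : Differentiable ℝ J3 := by unfold J3; fun_prop

theorem fderiv_position_mul_momentum_sub (i j : Fin 3) (z v : Phase) :
    fderiv ℝ (fun w : Phase => w.1 i * w.2 j - w.1 j * w.2 i) z v =
      z.1 i * v.2 j + v.1 i * z.2 j - (z.1 j * v.2 i + v.1 j * z.2 i) := by
  have h := ((hasFDerivAt_position i z).mul (hasFDerivAt_momentum j z)).sub
    ((hasFDerivAt_position j z).mul (hasFDerivAt_momentum i z))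
  have h' : HasFDerivAt (fun w : Phase => w.1 i * w.2 j - w.1 j * w.2 i) _ z := h
  rw [h'.fderiv]
  simp
  ring

theorem fderiv_J1 (z v : Phase) :
    fderiv ℝ J1 z v = z.1 1 * v.2 2 + v.1 1 * z.2 2 - (z.1 2 * v.2 1 + v.1 2 * z.2 1) :=
  fderiv_position_mul_momentum_sub 1 2 z v

theorem fderiv_J2 (z v : Phase) :
    fderiv ℝ J2 z v = z.1 2 * v.2 0 + v.1 2 * z.2 0 - (z.1 0 * v.2 2 + v.1 0 * z.2 2) :=
  fderiv_position_mul_momentum_sub 2 0 z v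

theorem fderiv_J3 (z v : Phase) :
    fderiv ℝ J3 z v = z.1 0 * v.2 1 + v.1 0 * z.2 1 - (z.1 1 * v.2 0 + v.1 1 * z.2 0) :=
  fderiv_position_mul_momentum_sub 0 1 z v

theorem fderiv_kowalevskyH (c : ℝ) (z v : Phase) :
    fderiv ℝ (fun w => J1 w ^ 2 + J2 w ^ 2 + 2 * J3 w ^ 2 + c * w.1 0) z v =
      2 * J1 z * fderiv ℝ J1 z v + 2 * J2 z * fderiv ℝ J2 z v + 4 * J3 z * fderiv ℝ J3 z v +
        c * v.1 0 := by
  have h := ((((differentiable_J1 z).hasFDerivAt.pow 2).add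
    ((differentiable_J2 z).hasFDerivAt.pow 2)).add
    (((differentiable_J3 z).hasFDerivAt.pow 2).const_mul 2)).add
    ((hasFDerivAt_position 0 z).const_mul c)
  have h' : HasFDerivAt (fun w => J1 w ^ 2 + J2 w ^ 2 + 2 * J3 w ^ 2 + c * w.1 0) _ z := h
  rw [h'.fderiv]
  simp
  ring

theorem fderiv_kowalevskyK (c : ℝ) (z v : Phase) :
    fderiv ℝ (fun w => (J1 w ^ 2 - J2 w ^ 2 - c * w.1 0) ^ 2 +
        (2 * J1 w * J2 w - c * w.1 1) ^ 2) z v =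
      2 * (J1 z ^ 2 - J2 z ^ 2 - c * z.1 0) *
          (2 * J1 z * fderiv ℝ J1 z v - 2 * J2 z * fderiv ℝ J2 z v - c * v.1 0) +
        2 * (2 * J1 z * J2 z - c * z.1 1) *
          (2 * (J1 z * fderiv ℝ J2 z v + J2 z * fderiv ℝ J1 z v) - c * v.1 1) := by
  have h := (((((differentiable_J1 z).hasFDerivAt.pow 2).sub
    ((differentiable_J2 z).hasFDerivAt.pow 2)).sub
    ((hasFDerivAt_position 0 z).const_mul c)).pow 2).add
    (((((differentiable_J1 z).hasFDerivAt.const_mul 2).mul (differentiable_J2 z).hasFDerivAt).sub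
    ((hasFDerivAt_position 1 z).const_mul c)).pow 2)
  have h' : HasFDerivAt (fun w => (J1 w ^ 2 - J2 w ^ 2 - c * w.1 0) ^ 2 +
      (2 * J1 w * J2 w - c * w.1 1) ^ 2) _ z := h
  rw [h'.fderiv]
  simp [-mul_eq_mul_left_iff]
  ring

theorem pb_sphereF₁_kowalevskyH (c : ℝ) (z : Phase) :
    pb sphereF₁ (fun w => J1 w ^ 2 + J2 w ^ 2 + 2 * J3 w ^ 2 + c * w.1 0) z = 0 := by
  simp only [pb, Fin.sum_univ_three, fderiv_sphereF₁, fderiv_kowalevskyH, fderiv_J1, fderiv_J2,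
    fderiv_J3]
  simp
  ring

theorem pb_sphereF₁_kowalevskyK (c : ℝ) (z : Phase) :
    pb sphereF₁ (fun w => (J1 w ^ 2 - J2 w ^ 2 - c * w.1 0) ^ 2 +
      (2 * J1 w * J2 w - c * w.1 1) ^ 2) z = 0 := by
  simp only [pb, Fin.sum_univ_three, fderiv_sphereF₁, fderiv_kowalevskyK, fderiv_J1, fderiv_J2]
  simp
  ring

theorem pb_kowalevskyH_kowalevskyK (c : ℝ) (z : Phase) :
    pb (fun w => J1 w ^ 2 + J2 w ^ 2 + 2 * J3 w ^ 2 + c * w.1 0)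
      (fun w => (J1 w ^ 2 - J2 w ^ 2 - c * w.1 0) ^ 2 +
        (2 * J1 w * J2 w - c * w.1 1) ^ 2) z = 0 := by
  simp only [pb, Fin.sum_univ_three, fderiv_kowalevskyH, fderiv_kowalevskyK, fderiv_J1, fderiv_J2,
    fderiv_J3]
  simp [J1, J2, J3]
  ring

/-- the Kowalevsky integrals H = J₁² + J₂² + 2J₃² + cx₁ and
K = (J₁² − J₂² − cx₁)² + (2J₁J₂ − cx₂)² are in involution with respect to the
sphere Dirac bracket on T*S². -/
theorem kowalevsky_sphere_involution
    (c : ℝ) (z : Phase)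
    (h1 : z.1 0 ^ 2 + z.1 1 ^ 2 + z.1 2 ^ 2 = 1)
    (h2 : z.1 0 * z.2 0 + z.1 1 * z.2 1 + z.1 2 * z.2 2 = 0) :
    diracS
      (fun w => J1 w ^ 2 + J2 w ^ 2 + 2 * J3 w ^ 2 + c * w.1 0)
      (fun w => (J1 w ^ 2 - J2 w ^ 2 - c * w.1 0) ^ 2 +
        (2 * J1 w * J2 w - c * w.1 1) ^ 2) z = 0 := by
  rw [diracS, dirac, pb_kowalevskyH_kowalevskyK, pb_sphereF₁_kowalevskyH, pb_sphereF₁_kowalevskyK]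
  simp
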